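/- Sandwich lemma for the Kripke logical relation: let Λ_{βη} be the clone of STLC terms modulo βη-equality, Nf(Γ;A) the set of terms βη-equal to an η-long β-normal form, Ne(Γ;A) the set of terms βη-equal to a neutral form, and Q the Kripke logical relation defined by Q(Γ;b) = Nf(Γ;b) and Q(Γ;A⇒B) = { t | for all renamings ρ ∈ Var(Δ;Γ) and a ∈ Q(Δ;A), app (t[ρ]) a ∈ Q(Δ;B) }. Then for every type A and context Γ, Ne(Γ;A) ⊆ Q(Γ;A) ⊆ Nf(Γ;A). -/

import Mathlib

/-- Simple types: freely generated by a base type and function types. -/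
inductive Ty : Type
  | base : Ty
  | arrow : Ty → Ty → Ty

/-- Intrinsically-typed de Bruijn terms of the simply typed λ-calculus
(α-equivalence classes of named terms). -/
inductive Tm : List Ty → Ty → Type
  | var : {Γ : List Ty} → (i : Fin Γ.length) → Tm Γ (Γ.get i)
  | app : {Γ : List Ty} → {A B : Ty} → Tm Γ (Ty.arrow A B) → Tm Γ A → Tm Γ B
  | lam : {Γ : List Ty} → {A B : Ty} → Tm (A :: Γ) B → Tm Γ (Ty.arrow A B)

/-- Variable renamings `Δ → Γ`: a sort-preserving choice of a variable of `Δ` for each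
variable of `Γ`. -/
def Ren (Δ Γ : List Ty) : Type := (i : Fin Γ.length) → { j : Fin Δ.length // Δ.get j = Γ.get i }

/-- Lift a renaming under a binder. -/
def Ren.lift {Δ Γ : List Ty} (ρ : Ren Δ Γ) (A : Ty) : Ren (A :: Δ) (A :: Γ) := fun i =>
  Fin.cases ⟨⟨0, by simp⟩, rfl⟩ (fun i' => ⟨(ρ i').1.succ, (ρ i').2⟩) i

/-- The weakening renaming `Γ → A :: Γ`. -/
def Ren.up (Δ : List Ty) (A : Ty) : Ren (A :: Δ) Δ := fun i => ⟨i.succ, rfl⟩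

/-- Renaming of variables in a term. -/
def Tm.rename : {Γ Δ : List Ty} → {A : Ty} → Tm Γ A → Ren Δ Γ → Tm Δ A
  | _, _, _, Tm.var i, ρ => (ρ i).2 ▸ Tm.var (ρ i).1
  | _, _, _, Tm.app f a, ρ => Tm.app (f.rename ρ) (a.rename ρ)
  | _, _, _, Tm.lam t, ρ => Tm.lam (t.rename (ρ.lift _))

/-- Simultaneous substitutions `Δ → Γ`. -/
def Sb (Δ Γ : List Ty) : Type := (i : Fin Γ.length) → Tm Δ (Γ.get i)

/-- Lift a substitution under a binder. -/
def Sb.lift {Δ Γ : List Ty} (σ : Sb Δ Γ) (A : Ty) : Sb (A :: Δ) (A :: Γ) := fun i =>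
  Fin.cases (Tm.var ⟨0, by simp⟩) (fun i' => (σ i').rename (Ren.up Δ A)) i

/-- Capture-avoiding simultaneous substitution. -/
def Tm.subst : {Γ Δ : List Ty} → {A : Ty} → Tm Γ A → Sb Δ Γ → Tm Δ A
  | _, _, _, Tm.var i, σ => σ i
  | _, _, _, Tm.app f a, σ => Tm.app (f.subst σ) (a.subst σ)
  | _, _, _, Tm.lam t, σ => Tm.lam (t.subst (σ.lift _))

/-- The substitution replacing the last-bound variable by `u` and leaving the others alone. -/
def Sb.single {Γ : List Ty} {A : Ty} (u : Tm Γ A) : Sb Γ (A :: Γ) := fun i =>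
  Fin.cases u (fun i' => Tm.var i') i
/-- βη-equality of simply typed λ-terms: the congruence generated by the β- and η-rules. -/
inductive BetaEta : {Γ : List Ty} → {A : Ty} → Tm Γ A → Tm Γ A → Prop
  | refl {Γ : List Ty} {A : Ty} {t : Tm Γ A} : BetaEta t t
  | symm {Γ : List Ty} {A : Ty} {t u : Tm Γ A} : BetaEta t u → BetaEta u t
  | trans {Γ : List Ty} {A : Ty} {t u v : Tm Γ A} : BetaEta t u → BetaEta u v → BetaEta t v
  | congApp {Γ : List Ty} {A B : Ty} {f f' : Tm Γ (Ty.arrow A B)} {a a' : Tm Γ A} :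
      BetaEta f f' → BetaEta a a' → BetaEta (Tm.app f a) (Tm.app f' a')
  | congLam {Γ : List Ty} {A B : Ty} {t t' : Tm (A :: Γ) B} :
      BetaEta t t' → BetaEta (Tm.lam t) (Tm.lam t')
  | beta {Γ : List Ty} {A B : Ty} (t : Tm (A :: Γ) B) (u : Tm Γ A) :
      BetaEta (Tm.app (Tm.lam t) u) (t.subst (Sb.single u))
  | eta {Γ : List Ty} {A B : Ty} (t : Tm Γ (Ty.arrow A B)) :
      BetaEta t (Tm.lam (Tm.app (t.rename (Ren.up Γ A)) (Tm.var ⟨0, by simp⟩)))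

/-- βη-equality is an equivalence relation on each term set. -/
def beSetoid (Γ : List Ty) (A : Ty) : Setoid (Tm Γ A) :=
  ⟨BetaEta, ⟨fun _ => BetaEta.refl, BetaEta.symm, BetaEta.trans⟩⟩
mutual
  /-- η-long β-normal forms. -/
  inductive NormalForm : {Γ : List Ty} → {A : Ty} → Tm Γ A → Prop
    | ofNeutral {Γ : List Ty} {t : Tm Γ Ty.base} : NeutralForm t → NormalForm t
    | lam {Γ : List Ty} {A B : Ty} {t : Tm (A :: Γ) B} : NormalForm t → NormalForm (Tm.lam t)
  /-- Neutral forms. -/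
  inductive NeutralForm : {Γ : List Ty} → {A : Ty} → Tm Γ A → Prop
    | var {Γ : List Ty} (i : Fin Γ.length) : NeutralForm (Tm.var i)
    | app {Γ : List Ty} {A B : Ty} {f : Tm Γ (Ty.arrow A B)} {a : Tm Γ A} :
        NeutralForm f → NormalForm a → NeutralForm (Tm.app f a)
end

/-- Terms βη-equal to a normal form. -/
def NfSet (Γ : List Ty) (A : Ty) : Set (Tm Γ A) := {t | ∃ n, NormalForm n ∧ BetaEta t n}

/-- Terms βη-equal to a neutral form. -/
def NeSet (Γ : List Ty) (A : Ty) : Set (Tm Γ A) := {t | ∃ n, NeutralForm n ∧ BetaEta t n}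

/-- The Kripke logical relation: `Q(Γ;b) = Nf(Γ;b)` and
`Q(Γ;A⇒B) = { t | ∀ ρ : Var(Δ;Γ), ∀ a ∈ Q(Δ;A), app (t[ρ]) a ∈ Q(Δ;B) }`. -/
def KQ : (A : Ty) → (Γ : List Ty) → Set (Tm Γ A)
  | Ty.base, Γ => NfSet Γ Ty.base
  | Ty.arrow A B, Γ =>
      {t | ∀ (Δ : List Ty) (ρ : Ren Δ Γ) (a : Tm Δ A), a ∈ KQ A Δ →
        Tm.app (t.rename ρ) a ∈ KQ B Δ}

theorem Tm.rename_cast {Γ Δ : List Ty} {A B : Ty} (h : A = B) (t : Tm Γ A) (ρ : Ren Δ Γ) :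
    (h ▸ t : Tm Γ B).rename ρ = h ▸ t.rename ρ := by
  subst h; rfl

theorem Tm.subst_cast {Γ Δ : List Ty} {A B : Ty} (h : A = B) (t : Tm Γ A) (σ : Sb Δ Γ) :
    (h ▸ t : Tm Γ B).subst σ = h ▸ t.subst σ := by
  subst h; rfl

theorem NeutralForm.cast {Γ : List Ty} {A B : Ty} (h : A = B) {t : Tm Γ A}
    (ht : NeutralForm t) : NeutralForm (h ▸ t : Tm Γ B) := by
  subst h; exact ht

/-- Composition of renamings. -/
def Ren.comp {Θ Δ Γ : List Ty} (ρ : Ren Δ Γ) (τ : Ren Θ Δ) : Ren Θ Γ := fun i =>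
  ⟨(τ (ρ i).1).1, (τ (ρ i).1).2.trans (ρ i).2⟩

theorem Ren.lift_comp {Θ Δ Γ : List Ty} (ρ : Ren Δ Γ) (τ : Ren Θ Δ) (A : Ty) :
    (ρ.lift A).comp (τ.lift A) = (ρ.comp τ).lift A := by
  funext i
  refine Fin.cases ?_ (fun i' => ?_) i <;> rfl

theorem Ren.up_comp_lift {Δ Γ : List Ty} (ρ : Ren Δ Γ) (A : Ty) :
    (Ren.up Γ A).comp (ρ.lift A) = ρ.comp (Ren.up Δ A) := rfl

theorem Tm.rename_rename {Γ : List Ty} {A : Ty} (t : Tm Γ A) :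
    ∀ {Δ Θ : List Ty} (ρ : Ren Δ Γ) (τ : Ren Θ Δ),
      (t.rename ρ).rename τ = t.rename (ρ.comp τ) := by
  induction t with
  | var i =>
    intro Δ Θ ρ τ
    simp only [Tm.rename, Tm.rename_cast, Ren.comp]
    grind
  | app f a ihf iha => intro Δ Θ ρ τ; simp only [Tm.rename, ihf, iha]
  | lam t ih => intro Δ Θ ρ τ; simp only [Tm.rename, ih, Ren.lift_comp]

theorem Tm.rename_up_rename_lift {Γ Δ : List Ty} {A B : Ty} (t : Tm Γ A) (ρ : Ren Δ Γ) :
    (t.rename (Ren.up Γ B)).rename (ρ.lift B) = (t.rename ρ).rename (Ren.up Δ B) := by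
  rw [Tm.rename_rename, Tm.rename_rename, Ren.up_comp_lift]

theorem Sb.lift_rename {Θ Δ Γ : List Ty} (σ : Sb Δ Γ) (τ : Ren Θ Δ) (A : Ty) :
    (fun i => (σ.lift A i).rename (τ.lift A)) = Sb.lift (fun i => (σ i).rename τ) A := by
  funext i
  refine Fin.cases ?_ (fun i' => ?_) i
  · rfl
  · exact Tm.rename_up_rename_lift (σ i') τ

theorem Tm.subst_rename {Γ : List Ty} {A : Ty} (t : Tm Γ A) :
    ∀ {Δ Θ : List Ty} (σ : Sb Δ Γ) (τ : Ren Θ Δ),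
      (t.subst σ).rename τ = t.subst (fun i => (σ i).rename τ) := by
  induction t with
  | var i => intro Δ Θ σ τ; rfl
  | app f a ihf iha => intro Δ Θ σ τ; simp only [Tm.rename, Tm.subst, ihf, iha]
  | lam t ih => intro Δ Θ σ τ; simp only [Tm.rename, Tm.subst, ih, Sb.lift_rename]

/-- Precomposition of a substitution with a renaming. -/
def Ren.compSb {Θ Δ Γ : List Ty} (ρ : Ren Δ Γ) (σ : Sb Θ Δ) : Sb Θ Γ := fun i =>
  (ρ i).2 ▸ σ (ρ i).1

theorem Ren.lift_compSb {Θ Δ Γ : List Ty} (ρ : Ren Δ Γ) (σ : Sb Θ Δ) (A : Ty) :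
    (ρ.lift A).compSb (σ.lift A) = (ρ.compSb σ).lift A := by
  funext i
  refine Fin.cases ?_ (fun i' => ?_) i
  · rfl
  · exact (Tm.rename_cast (ρ i').2 (σ (ρ i').1) (Ren.up Θ A)).symm

theorem Tm.rename_subst {Γ : List Ty} {A : Ty} (t : Tm Γ A) :
    ∀ {Δ Θ : List Ty} (ρ : Ren Δ Γ) (σ : Sb Θ Δ),
      (t.rename ρ).subst σ = t.subst (ρ.compSb σ) := by
  induction t with
  | var i => intro Δ Θ ρ σ; exact Tm.subst_cast (ρ i).2 (Tm.var (ρ i).1) σ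
  | app f a ihf iha => intro Δ Θ ρ σ; simp only [Tm.rename, Tm.subst, ihf, iha]
  | lam t ih => intro Δ Θ ρ σ; simp only [Tm.rename, Tm.subst, ih, Ren.lift_compSb]

theorem Tm.subst_single_rename {Γ Δ : List Ty} {A B : Ty} (t : Tm (A :: Γ) B) (u : Tm Γ A)
    (ρ : Ren Δ Γ) :
    (t.subst (Sb.single u)).rename ρ = (t.rename (ρ.lift A)).subst (Sb.single (u.rename ρ)) := by
  rw [Tm.subst_rename, Tm.rename_subst]
  congr 1
  funext i
  refine Fin.cases ?_ (fun i' => ?_) i <;> rfl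

theorem BetaEta.rename {Γ : List Ty} {A : Ty} {t u : Tm Γ A} (h : BetaEta t u) :
    ∀ {Δ : List Ty} (ρ : Ren Δ Γ), BetaEta (t.rename ρ) (u.rename ρ) := by
  induction h with
  | refl => intro Δ ρ; exact .refl
  | symm _ ih => intro Δ ρ; exact .symm (ih ρ)
  | trans _ _ ih₁ ih₂ => intro Δ ρ; exact .trans (ih₁ ρ) (ih₂ ρ)
  | congApp _ _ ih₁ ih₂ => intro Δ ρ; exact .congApp (ih₁ ρ) (ih₂ ρ)
  | congLam _ ih => intro Δ ρ; exact .congLam (ih (ρ.lift _))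
  | beta t u => intro Δ ρ; rw [Tm.subst_single_rename]; exact .beta _ _
  | @eta Γ A B t =>
    intro Δ ρ
    have h := BetaEta.eta (t.rename ρ)
    rw [← Tm.rename_up_rename_lift] at h
    exact h

mutual
theorem NormalForm.rename : ∀ {Γ Δ : List Ty} {A : Ty} {t : Tm Γ A}, NormalForm t →
    ∀ ρ : Ren Δ Γ, NormalForm (t.rename ρ)
  | _, _, _, _, .ofNeutral h, ρ => .ofNeutral (h.rename ρ)
  | _, _, _, _, .lam h, ρ => .lam (h.rename (ρ.lift _))

theorem NeutralForm.rename : ∀ {Γ Δ : List Ty} {A : Ty} {t : Tm Γ A}, NeutralForm t →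
    ∀ ρ : Ren Δ Γ, NeutralForm (t.rename ρ)
  | _, _, _, _, .var i, ρ => .cast (ρ i).2 (.var (ρ i).1)
  | _, _, _, _, .app hf ha, ρ => .app (hf.rename ρ) (ha.rename ρ)
end

/-- Sandwich lemma for the Kripke logical relation: `Ne(Γ;A) ⊆ Q(Γ;A) ⊆ Nf(Γ;A)`. -/
theorem kripke_sandwich (A : Ty) (Γ : List Ty) :
    NeSet Γ A ⊆ KQ A Γ ∧ KQ A Γ ⊆ NfSet Γ A := by
  induction A generalizing Γ with
  | base =>
    exact ⟨fun _ ⟨n, hn, htn⟩ => ⟨n, .ofNeutral hn, htn⟩, fun _ ht => ht⟩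
  | arrow A B ihA ihB =>
    constructor
    · rintro t ⟨n, hn, htn⟩ Δ ρ a ha
      obtain ⟨m, hm, ham⟩ := (ihA Δ).2 ha
      exact (ihB Δ).1 ⟨_, .app (hn.rename ρ) hm, .congApp (htn.rename ρ) ham⟩
    · intro t ht
      have hvar : (Tm.var ⟨0, by simp⟩ : Tm (A :: Γ) A) ∈ KQ A (A :: Γ) :=
        (ihA (A :: Γ)).1 ⟨_, .var _, .refl⟩
      obtain ⟨n, hn, htn⟩ := (ihB (A :: Γ)).2 (ht (A :: Γ) (Ren.up Γ A) _ hvar)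
      exact ⟨_, .lam hn, .trans (.eta t) (.congLam htn)⟩
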